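/- Under assumptions (a)–(c) and the SMG iterates with arbitrary permutations, let T ≥ 2 and choose the cosine annealing learning rate η_t := (γ/T^{1/3})·(1 + cos(t·π/T)) for t = 1,…,T with γ > 0, and assume 2·γ/T^{1/3} ≤ 1/(L·√K) (so that η_t ≤ 1/(L·√K) for every t), where K := max{5/2, 9(5−3β)(Θ+1)/(1−β)}. Then (1/Σ_{t=1}^T η_t) · Σ_{t=1}^T η_t·‖∇F(w̃_{t−1})‖² ≤ (1/T^{2/3}) · ( 8·(F(w̃_0) − F_*)/((1−β)·γ) + 144·σ²·(5−3β)·L²·γ²/(1−β) ). -/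

import Mathlib

open Finset

section ScalarEstimates

/-- The cosine values at the nodes `tπ/T`, `1 ≤ t ≤ T`, sum to `-1`. -/
lemma sum_Icc_cos_mul_pi_div (T : ℕ) (hT : 1 ≤ T) :
    ∑ t ∈ Icc 1 T, Real.cos ((t : ℝ) * Real.pi / T) = -1 := by
  have hT0 : (T : ℝ) ≠ 0 := by positivity
  have hfull : ∑ t ∈ range (T + 1), Real.cos ((t : ℝ) * Real.pi / T) = 0 := by
    have hrefl := sum_range_reflect (fun t : ℕ => Real.cos ((t : ℝ) * Real.pi / T)) (T + 1)
    have hneg : ∑ t ∈ range (T + 1), Real.cos (((T + 1 - 1 - t : ℕ) : ℝ) * Real.pi / T)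
        = -∑ t ∈ range (T + 1), Real.cos ((t : ℝ) * Real.pi / T) := by
      rw [← sum_neg_distrib]
      refine sum_congr rfl fun t ht => ?_
      have htT : t ≤ T := by simpa [Nat.lt_succ_iff] using ht
      rw [← Real.cos_pi_sub, Nat.add_sub_cancel, Nat.cast_sub htT]
      congr 1
      field_simp
    linarith
  rw [Finset.range_eq_Ico, sum_eq_sum_Ico_succ_bot (by omega)] at hfull
  have hIcc : Icc 1 T = Ico (0 + 1) (T + 1) := by ext; simp
  rw [hIcc]
  simp only [Nat.cast_zero, zero_mul, zero_div, Real.cos_zero] at hfull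
  linarith

lemma sum_range_cast_le (n : ℕ) : ∑ i ∈ range n, (i : ℝ) ≤ (n : ℝ) ^ 2 / 2 := by
  induction n with
  | zero => simp
  | succ k ih => rw [sum_range_succ]; push_cast; nlinarith

lemma sum_range_cast_sq_le (n : ℕ) : ∑ i ∈ range n, (i : ℝ) ^ 2 ≤ (n : ℝ) ^ 3 / 3 := by
  induction n with
  | zero => simp
  | succ k ih =>
    rw [sum_range_succ]; push_cast
    nlinarith [(Nat.cast_nonneg k : (0 : ℝ) ≤ k)]

/-- One-epoch balance of the within-epoch drift `a`, the end-of-epoch drift `b` and the squared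
momentum norm, which changes from `M` to `M'`. -/
lemma drift_balance {β p G S E M M' a b : ℝ} (hβ0 : 0 ≤ β) (hβ1 : β < 1)
    (hp : 0 ≤ p) (hp45 : p ≤ 1 / 45) (hpβ : p ≤ (1 - β) / 18)
    (hG : 0 ≤ G) (hS : 0 ≤ S) (hE : 0 ≤ E) (hM : 0 ≤ M) (ha : 0 ≤ a)
    (hpE : p * E ≤ (1 - β) / 18 * G + p * S)
    (h₁ : a ≤ p * (β / 3 * M + 3 / 2 * (1 - β) * (E + a)))
    (h₂ : b ≤ p * (β * M + 3 * (1 - β) * (E + a)))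
    (h₃ : M' ≤ 2 * G + 2 * a) :
    1 / 2 * (1 - β) * a + 1 / 2 * β * b + 3 / 4 * p * M'
      ≤ 3 / 4 * p * M + (1 - β) / 4 * G + 9 / 2 * (p * S) := by
  have hα : 0 ≤ 1 - β := by linarith
  have hpa : p * a ≤ 1 / 45 * a := by gcongr
  have hαpa : (1 - β) * (p * a) ≤ 1 / 45 * a := by nlinarith [mul_nonneg hp ha]
  have hpM : 0 ≤ p * M := mul_nonneg hp hM
  have hβpM : β * (p * M) ≤ p * M := by nlinarith
  have hX : 0 ≤ p * E := mul_nonneg hp hE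
  have hαX : 0 ≤ (1 - β) * (p * E) := mul_nonneg hα hX
  have haub : a ≤ 30 / 29 * (1 / 3 * (p * M) + 3 / 2 * ((1 - β) * (p * E))) := by nlinarith
  have hβb : β * b ≤ p * M + 3 * β * ((1 - β) * (p * E)) + 3 * ((1 - β) * (p * a)) := by
    have h4 : β * b ≤ β * (p * (β * M + 3 * (1 - β) * (E + a))) := by gcongr
    have h5 : β * (β * (p * M)) ≤ p * M := by nlinarith
    have h6 : β * ((1 - β) * (p * a)) ≤ (1 - β) * (p * a) := by
      nlinarith [mul_nonneg hα (mul_nonneg hp ha)]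
    nlinarith
  have hM' : p * M' ≤ 2 * (p * G) + 2 * (p * a) := by nlinarith
  have hpG : p * G ≤ (1 - β) / 18 * G := by gcongr
  have hαa : (1 - β) * a ≤ 30 / 29 * (1 / 3 * (p * M) + 3 / 2 * (1 - β) * ((1 - β) * (p * E))) := by
    have := mul_le_mul_of_nonneg_left haub hα
    nlinarith
  have hαX' : (1 - β) * (p * E) ≤ (1 - β) / 18 * G + p * S := by
    have : (1 - β) * (p * E) ≤ p * E := by nlinarith
    linarith
  have hββ : (1 - β) * ((1 - β) * (p * E)) + β * ((1 - β) * (p * E)) = (1 - β) * (p * E) := by ring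
  have h7 : 0 ≤ β * ((1 - β) * (p * E)) := mul_nonneg hβ0 hαX
  have hαG : 0 ≤ (1 - β) * G := mul_nonneg hα hG
  have hpS : 0 ≤ p * S := mul_nonneg hp hS
  nlinarith

/-- Lower bound for the total cosine-annealed step size. -/
lemma le_sum_cosine_annealing {γ : ℝ} (hγ : 0 ≤ γ) (T : ℕ) (hT : 2 ≤ T) :
    γ * ((T : ℝ) ^ ((1 : ℝ) / 3)) ^ 2 / 2
      ≤ ∑ t ∈ Icc 1 T, γ / (T : ℝ) ^ ((1 : ℝ) / 3) * (1 + Real.cos ((t : ℝ) * Real.pi / T)) := by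
  have hT2 : (2 : ℝ) ≤ T := by exact_mod_cast hT
  have hR : (0 : ℝ) < (T : ℝ) ^ ((1 : ℝ) / 3) := by positivity
  have hR3 : ((T : ℝ) ^ ((1 : ℝ) / 3)) ^ 3 = T := by
    rw [← Real.rpow_mul_natCast (by linarith)]; norm_num
  rw [← mul_sum, sum_add_distrib, sum_Icc_cos_mul_pi_div T (by omega), sum_const, Nat.card_Icc,
    Nat.add_sub_cancel, nsmul_eq_mul, mul_one, div_mul_eq_mul_div, le_div_iff₀ hR]
  calc γ * ((T : ℝ) ^ ((1 : ℝ) / 3)) ^ 2 / 2 * (T : ℝ) ^ ((1 : ℝ) / 3)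
      = γ * (((T : ℝ) ^ ((1 : ℝ) / 3)) ^ 3 / 2) := by ring
    _ ≤ γ * ((T : ℝ) + -1) := by rw [hR3]; gcongr; linarith

/-- Bounds on `(L c)²` implied by the step-size restriction `c ≤ 1 / (L √K)`. -/
lemma stepsize_constants {L c Θ β : ℝ} (hL : 0 < L) (hc : 0 ≤ c) (hΘ : 0 ≤ Θ) (hβ0 : 0 ≤ β)
    (hβ1 : β < 1)
    (hcK : c ≤ 1 / (L * Real.sqrt (max (5 / 2) (9 * (5 - 3 * β) * (Θ + 1) / (1 - β))))) :
    L ^ 2 * c ^ 2 ≤ 1 / 45 ∧ L ^ 2 * c ^ 2 * (Θ + 1) ≤ (1 - β) / 18 := by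
  have hα : 0 < 1 - β := by linarith
  set K := max (5 / 2) (9 * (5 - 3 * β) * (Θ + 1) / (1 - β)) with hKdef
  have hK0 : 0 < K := lt_of_lt_of_le (by norm_num) (le_max_left _ _)
  set p := L ^ 2 * c ^ 2 with hp
  have hp0 : 0 ≤ p := by positivity
  have hpK : p * K ≤ 1 := by
    have hsqrt : 0 < Real.sqrt K := Real.sqrt_pos.2 hK0
    rw [le_div_iff₀ (by positivity)] at hcK
    have h := pow_le_one₀ (n := 2) (by positivity) hcK
    rw [mul_pow, mul_pow, Real.sq_sqrt hK0.le] at h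
    rw [hp]; linarith
  have hpKΘ : p * (Θ + 1) * (9 * (5 - 3 * β)) ≤ 1 - β := by
    have h' : p * (9 * (5 - 3 * β) * (Θ + 1) / (1 - β)) ≤ 1 :=
      (mul_le_mul_of_nonneg_left (le_max_right _ _) hp0).trans hpK
    rw [← mul_div_assoc, div_le_one hα] at h'
    linarith
  have hpΘ0 : 0 ≤ p * (Θ + 1) := by positivity
  refine ⟨?_, by nlinarith⟩
  have h45 : (p * (Θ + 1) * 45) * (1 - β) ≤ 1 * (1 - β) := by nlinarith
  have h1 : p * (Θ + 1) * 45 ≤ 1 := le_of_mul_le_mul_right h45 hα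
  nlinarith

/-- Telescoping of a potential `u t + η t * Φ t` with nonincreasing weights `η`. -/
lemma weighted_sum_le_of_potential {β N : ℝ} {T : ℕ} {u η Φ G : ℕ → ℝ} (hβ0 : 0 ≤ β)
    (hη : ∀ t, 1 ≤ t → t ≤ T → 0 ≤ η t) (hanti : ∀ t, 1 ≤ t → t + 1 ≤ T → η (t + 1) ≤ η t)
    (hΦ : ∀ t, 0 ≤ Φ t) (hG : ∀ t, 0 ≤ G t) (hΦG : Φ 0 = 1 / 2 * β * G 1)
    (hstep : ∀ t, 1 ≤ t → t ≤ T → u t + η t * Φ t ≤ u (t - 1) + η t * Φ (t - 1)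
      - η t * (1 / 2 * G t) + η t * ((1 - β) / 4 * G t) + η t * N) (t : ℕ) (ht : 1 ≤ t) :
    t ≤ T → u t + η t * Φ t + (1 - β) / 4 * ∑ s ∈ Icc 1 t, η s * G s
      ≤ u 0 + N * ∑ s ∈ Icc 1 t, η s := by
  induction t, ht using Nat.le_induction with
  | base =>
    intro hT
    have h := hstep 1 le_rfl hT
    simp only [Nat.sub_self, hΦG] at h
    simp only [Icc_self, sum_singleton]
    linarith
  | succ t ht ih =>
    intro hT
    have h := hstep (t + 1) (by omega) hT
    have ih' := ih (by omega)
    rw [Nat.add_sub_cancel] at h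
    rw [sum_Icc_succ_top (by omega), sum_Icc_succ_top (by omega)]
    have hmono : η (t + 1) * Φ t ≤ η t * Φ t :=
      mul_le_mul_of_nonneg_right (hanti t ht hT) (hΦ t)
    have hβG : 0 ≤ β * (η (t + 1) * G (t + 1)) :=
      mul_nonneg hβ0 (mul_nonneg (hη (t + 1) (by omega) hT) (hG _))
    linarith

/-- From a bound on a weighted sum `X` with total weight `S` to the bound on the average. -/
lemma weighted_average_le {β γ R L σ Δ S X : ℝ} (hβ1 : β < 1) (hγ : 0 < γ)
    (hR : 0 < R) (hΔ : 0 ≤ Δ) (hS : γ * R ^ 2 / 2 ≤ S)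
    (hX : (1 - β) / 4 * X ≤ Δ + 9 / 2 * (L ^ 2 * (2 * γ / R) ^ 2 * σ ^ 2) * S) :
    X / S ≤ (1 / R ^ 2) * (8 * Δ / ((1 - β) * γ)
      + 144 * σ ^ 2 * (5 - 3 * β) * L ^ 2 * γ ^ 2 / (1 - β)) := by
  have hα : 0 < 1 - β := by linarith
  have hS0 : 0 < S := lt_of_lt_of_le (by positivity) hS
  rw [div_le_iff₀ hS0]
  set P := L ^ 2 * (2 * γ / R) ^ 2 * σ ^ 2 with hP
  have hP0 : 0 ≤ P := by positivity
  have hnoise : 9 / 2 * P * S ≤ 9 * (5 - 3 * β) * P * S := by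
    have : 9 / 2 * P ≤ 9 * (5 - 3 * β) * P :=
      mul_le_mul_of_nonneg_right (by linarith) hP0
    exact mul_le_mul_of_nonneg_right this hS0.le
  have hgap : Δ ≤ 2 * Δ / (γ * R ^ 2) * S := by
    calc Δ = 2 * Δ / (γ * R ^ 2) * (γ * R ^ 2 / 2) := by field_simp
      _ ≤ _ := by gcongr
  have hrw : (1 - β) / 4 * ((1 / R ^ 2) * (8 * Δ / ((1 - β) * γ)
      + 144 * σ ^ 2 * (5 - 3 * β) * L ^ 2 * γ ^ 2 / (1 - β)) * S)
      = 2 * Δ / (γ * R ^ 2) * S + 9 * (5 - 3 * β) * P * S := by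
    rw [hP]; field_simp; ring
  have hα4 : 0 < (1 - β) / 4 := by positivity
  refine le_of_mul_le_mul_left ?_ hα4
  rw [hrw]
  linarith

end ScalarEstimates

section Smooth

lemma norm_add_three_sq_le {E : Type*} [SeminormedAddCommGroup E] (x y z : E) :
    ‖x + y + z‖ ^ 2 ≤ 3 * (‖x‖ ^ 2 + ‖y‖ ^ 2 + ‖z‖ ^ 2) := by
  have h := norm_add₃_le (a := x) (b := y) (c := z)
  have h0 := norm_nonneg (x + y + z)
  nlinarith [sq_nonneg (‖x‖ - ‖y‖), sq_nonneg (‖x‖ - ‖z‖), sq_nonneg (‖y‖ - ‖z‖)]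

lemma norm_sum_sq_le_card_mul {E ι : Type*} [SeminormedAddCommGroup E] (s : Finset ι) (x : ι → E) :
    ‖∑ i ∈ s, x i‖ ^ 2 ≤ #s * ∑ i ∈ s, ‖x i‖ ^ 2 :=
  (pow_le_pow_left₀ (norm_nonneg _) (norm_sum_le s x) 2).trans sq_sum_le_card_mul_sum_sq

variable {E : Type*} [NormedAddCommGroup E] [InnerProductSpace ℝ E]

lemma norm_convexCombo_sq_le {β : ℝ} (hβ0 : 0 ≤ β) (hβ1 : β ≤ 1) (x y : E) :
    ‖β • x + (1 - β) • y‖ ^ 2 ≤ β * ‖x‖ ^ 2 + (1 - β) * ‖y‖ ^ 2 := by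
  have h : ‖β • x + (1 - β) • y‖ ≤ β * ‖x‖ + (1 - β) * ‖y‖ := by
    refine (norm_add_le _ _).trans_eq ?_
    rw [norm_smul, norm_smul, Real.norm_of_nonneg hβ0, Real.norm_of_nonneg (sub_nonneg.2 hβ1)]
  have h0 := norm_nonneg (β • x + (1 - β) • y)
  nlinarith [mul_nonneg (mul_nonneg hβ0 (sub_nonneg.2 hβ1)) (sq_nonneg (‖x‖ - ‖y‖))]

/-- The squared norm of an average is at most the average of the squared norms. -/
lemma norm_average_sq_le {n : ℕ} (hn : 1 ≤ n) (x : ℕ → E) :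
    ‖(n : ℝ)⁻¹ • ∑ i ∈ range n, x i‖ ^ 2 ≤ (n : ℝ)⁻¹ * ∑ i ∈ range n, ‖x i‖ ^ 2 := by
  have hn0 : (0 : ℝ) < n := by exact_mod_cast hn
  rw [norm_smul, mul_pow, norm_inv, Real.norm_natCast]
  calc ((n : ℝ)⁻¹) ^ 2 * ‖∑ i ∈ range n, x i‖ ^ 2
      ≤ ((n : ℝ)⁻¹) ^ 2 * (#(range n) * ∑ i ∈ range n, ‖x i‖ ^ 2) := by
        gcongr; exact norm_sum_sq_le_card_mul _ _
    _ = (n : ℝ)⁻¹ * ∑ i ∈ range n, ‖x i‖ ^ 2 := by rw [card_range]; field_simp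

/-- A function with `L`-Lipschitz gradient lies below its quadratic upper model. -/
lemma le_quadratic_of_lipschitz_gradient [CompleteSpace E] {F : E → ℝ} {L : ℝ}
    (hF : Differentiable ℝ F)
    (hL : ∀ x y, ‖gradient F x - gradient F y‖ ≤ L * ‖x - y‖) (x h : E) :
    F (x + h) ≤ F x + inner ℝ (gradient F x) h + L / 2 * ‖h‖ ^ 2 := by
  have hder : ∀ s : ℝ, HasDerivAt (fun s : ℝ => F (x + s • h))
      (inner ℝ (gradient F (x + s • h)) h) s := by
    intro s
    have hline : HasDerivAt (fun s : ℝ => x + s • h) h s := by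
      simpa using ((hasDerivAt_id s).smul_const h).const_add x
    have := (hF (x + s • h)).hasFDerivAt.comp_hasDerivAt s hline
    rwa [← inner_gradient_left] at this
  have hmodel : ∀ s : ℝ, HasDerivAt
      (fun s : ℝ => F x + s * inner ℝ (gradient F x) h + s ^ 2 * (L / 2 * ‖h‖ ^ 2))
      (inner ℝ (gradient F x) h + 2 * s * (L / 2 * ‖h‖ ^ 2)) s := by
    intro s
    have := (((hasDerivAt_id s).mul_const (inner ℝ (gradient F x) h)).const_add (F x)).fun_add
      (((hasDerivAt_id s).fun_pow 2).mul_const (L / 2 * ‖h‖ ^ 2))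
    simpa using this
  have hle := image_le_of_deriv_right_le_deriv_boundary (a := 0) (b := 1)
    (fun s _ => (hder s).continuousAt.continuousWithinAt) (fun s _ => (hder s).hasDerivWithinAt)
    (by simp) (fun s _ => (hmodel s).continuousAt.continuousWithinAt)
    (fun s _ => (hmodel s).hasDerivWithinAt) (fun s hs => ?_)
    (Set.right_mem_Icc.2 zero_le_one)
  · simpa using hle
  · have h1 : inner ℝ (gradient F (x + s • h) - gradient F x) h ≤ L * ‖s • h‖ * ‖h‖ := by
      refine (real_inner_le_norm _ _).trans ?_
      gcongr
      simpa using hL (x + s • h) x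
    rw [inner_sub_left, norm_smul, Real.norm_of_nonneg hs.1] at h1
    nlinarith

/-- Descent along an inexact gradient step of length at most `1/L`. -/
lemma descent_of_inexact_gradient_step [CompleteSpace E] {F : E → ℝ} {L s : ℝ}
    (hF : Differentiable ℝ F)
    (hL : ∀ x y, ‖gradient F x - gradient F y‖ ≤ L * ‖x - y‖)
    (hs : 0 ≤ s) (hLs : L * s ≤ 1) (x u : E) :
    F (x - s • u) ≤ F x - s / 2 * ‖gradient F x‖ ^ 2 + s / 2 * ‖gradient F x - u‖ ^ 2 := by
  have h := le_quadratic_of_lipschitz_gradient hF hL x (-(s • u))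
  rw [← sub_eq_add_neg, inner_neg_right, inner_smul_right, norm_neg, norm_smul,
    Real.norm_of_nonneg hs] at h
  have hsq := norm_sub_sq_real (gradient F x) u
  have : s * (L * s) * ‖u‖ ^ 2 ≤ s * 1 * ‖u‖ ^ 2 := by gcongr
  nlinarith

end Smooth

section Epoch

variable {E : Type*} [NormedAddCommGroup E] [InnerProductSpace ℝ E]

/-- A partial sum of momentum steps, in terms of a reference gradient `D`, the dispersion of the
components `h` around `D`, and the error between `g` and `h`. -/
lemma norm_sum_momentum_sq_le {n : ℕ} {s : Finset ℕ} (hs : s ⊆ range n) {β : ℝ} (hβ0 : 0 ≤ β)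
    (hβ1 : β ≤ 1) (m D : E) (g h : ℕ → E) :
    ‖∑ j ∈ s, (β • m + (1 - β) • g j)‖ ^ 2
      ≤ β * ((#s : ℝ) ^ 2 * ‖m‖ ^ 2) + 3 * (1 - β) * ((#s : ℝ) ^ 2 * ‖D‖ ^ 2
        + #s * (∑ j ∈ range n, ‖h j - D‖ ^ 2 + ∑ j ∈ range n, ‖g j - h j‖ ^ 2)) := by
  have hsplit : ∑ j ∈ s, (β • m + (1 - β) • g j)
      = β • ((#s : ℝ) • m) + (1 - β) • ∑ j ∈ s, g j := by
    rw [sum_add_distrib, sum_const, ← smul_sum, smul_comm, Nat.cast_smul_eq_nsmul]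
  have hg : ∑ j ∈ s, g j = (#s : ℝ) • D + ∑ j ∈ s, (h j - D) + ∑ j ∈ s, (g j - h j) := by
    rw [sum_sub_distrib, sum_sub_distrib, sum_const, Nat.cast_smul_eq_nsmul]
    abel
  have hpart : ∀ x : ℕ → E, ‖∑ j ∈ s, x j‖ ^ 2 ≤ #s * ∑ j ∈ range n, ‖x j‖ ^ 2 := fun x =>
    (norm_sum_sq_le_card_mul s x).trans (by gcongr)
  have hscale : ∀ x : E, ‖(#s : ℝ) • x‖ ^ 2 = (#s : ℝ) ^ 2 * ‖x‖ ^ 2 := fun x => by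
    rw [norm_smul, mul_pow, Real.norm_natCast]
  have hsum : ‖∑ j ∈ s, g j‖ ^ 2 ≤ 3 * ((#s : ℝ) ^ 2 * ‖D‖ ^ 2
        + #s * (∑ j ∈ range n, ‖h j - D‖ ^ 2 + ∑ j ∈ range n, ‖g j - h j‖ ^ 2)) := by
    rw [hg]
    refine (norm_add_three_sq_le _ _ _).trans ?_
    rw [hscale]
    linarith [hpart fun j => h j - D, hpart fun j => g j - h j]
  rw [hsplit]
  refine (norm_convexCombo_sq_le hβ0 hβ1 _ _).trans ?_
  rw [hscale]
  have := mul_le_mul_of_nonneg_left hsum (sub_nonneg.2 hβ1)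
  linarith

lemma epoch_displacement_eq {n : ℕ} {c : ℝ} {w x : ℕ → E}
    (hw : ∀ i, i < n → w (i + 1) = w i - c • x i) {i j : ℕ} (hij : i ≤ j) (hjn : j ≤ n) :
    w j - w i = -(c • ∑ k ∈ Ico i j, x k) := by
  induction j, hij using Nat.le_induction with
  | base => simp
  | succ j hij ih =>
    rw [hw j (by omega), sum_Ico_succ_top hij, smul_add, neg_add, ← ih (by omega)]
    abel

lemma epoch_displacement_sq_le {n : ℕ} (hn : 1 ≤ n) {β η V a : ℝ} (hβ0 : 0 ≤ β)
    (hβ1 : β ≤ 1) {m D : E} {w g h : ℕ → E}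
    (hw : ∀ i, i < n → w (i + 1) = w i - (η / (n : ℝ)) • (β • m + (1 - β) • g i))
    (hV : (n : ℝ)⁻¹ * ∑ j ∈ range n, ‖h j - D‖ ^ 2 ≤ V)
    (ha : (n : ℝ)⁻¹ * ∑ j ∈ range n, ‖g j - h j‖ ^ 2 ≤ a) {i j : ℕ} (hij : i ≤ j) (hjn : j ≤ n) :
    ‖w j - w i‖ ^ 2 ≤ η ^ 2 * (β * ((((j - i : ℕ) : ℝ) / n) ^ 2 * ‖m‖ ^ 2)
      + 3 * (1 - β) * ((((j - i : ℕ) : ℝ) / n) ^ 2 * ‖D‖ ^ 2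
        + ((j - i : ℕ) : ℝ) / n * (V + a))) := by
  have hn0 : (0 : ℝ) < n := by exact_mod_cast hn
  have hβ1' := sub_nonneg.2 hβ1
  have hsub : Ico i j ⊆ range n := fun k hk => by
    simp only [mem_Ico, mem_range] at *; omega
  rw [inv_mul_le_iff₀ hn0] at hV ha
  rw [epoch_displacement_eq hw hij hjn, norm_neg, norm_smul, mul_pow, Real.norm_eq_abs, sq_abs]
  have hblock := norm_sum_momentum_sq_le hsub hβ0 hβ1 m D g h
  rw [Nat.card_Ico] at hblock
  calc (η / n) ^ 2 * ‖∑ k ∈ Ico i j, (β • m + (1 - β) • g k)‖ ^ 2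
      ≤ (η / n) ^ 2 * (β * (((j - i : ℕ) : ℝ) ^ 2 * ‖m‖ ^ 2)
        + 3 * (1 - β) * (((j - i : ℕ) : ℝ) ^ 2 * ‖D‖ ^ 2
          + ((j - i : ℕ) : ℝ) * (n * V + n * a))) := by
        refine mul_le_mul_of_nonneg_left (hblock.trans ?_) (sq_nonneg _)
        gcongr
    _ = _ := by field_simp

/-- Mean squared drift from the first iterate of an epoch. -/
lemma mean_drift_from_start_le {n : ℕ} (hn : 1 ≤ n) {β η V a : ℝ} (hβ0 : 0 ≤ β)
    (hβ1 : β ≤ 1) {m D : E} {w g h : ℕ → E}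
    (hw : ∀ i, i < n → w (i + 1) = w i - (η / (n : ℝ)) • (β • m + (1 - β) • g i))
    (hV : (n : ℝ)⁻¹ * ∑ j ∈ range n, ‖h j - D‖ ^ 2 ≤ V)
    (ha : (n : ℝ)⁻¹ * ∑ j ∈ range n, ‖g j - h j‖ ^ 2 ≤ a) :
    (n : ℝ)⁻¹ * ∑ i ∈ range n, ‖w i - w 0‖ ^ 2
      ≤ η ^ 2 * (β / 3 * ‖m‖ ^ 2 + 3 / 2 * (1 - β) * (‖D‖ ^ 2 + V + a)) := by
  have hn0 : (0 : ℝ) < n := by exact_mod_cast hn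
  have hβ1' := sub_nonneg.2 hβ1
  have hV0 : 0 ≤ V := le_trans (by positivity) hV
  have ha0 : 0 ≤ a := le_trans (by positivity) ha
  set P := η ^ 2 * (β * ‖m‖ ^ 2 + 3 * (1 - β) * ‖D‖ ^ 2) with hP
  set Q := η ^ 2 * (3 * (1 - β) * (V + a)) with hQ
  have hP0 : 0 ≤ P := by positivity
  have hQ0 : 0 ≤ Q := by positivity
  have hterm : ∀ i ∈ range n, ‖w i - w 0‖ ^ 2 ≤ (i : ℝ) ^ 2 * (P / n ^ 2) + i * (Q / n) := by
    intro i hi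
    refine (epoch_displacement_sq_le hn hβ0 hβ1 hw hV ha (Nat.zero_le i)
      (mem_range.1 hi).le).trans_eq ?_
    rw [hP, hQ, Nat.sub_zero]
    field_simp
    ring
  rw [inv_mul_le_iff₀ hn0]
  calc ∑ i ∈ range n, ‖w i - w 0‖ ^ 2
      ≤ ∑ i ∈ range n, ((i : ℝ) ^ 2 * (P / n ^ 2) + i * (Q / n)) := sum_le_sum hterm
    _ = (∑ i ∈ range n, (i : ℝ) ^ 2) * (P / n ^ 2) + (∑ i ∈ range n, (i : ℝ)) * (Q / n) := by
        rw [sum_add_distrib, sum_mul, sum_mul]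
    _ ≤ (n : ℝ) ^ 3 / 3 * (P / n ^ 2) + (n : ℝ) ^ 2 / 2 * (Q / n) := by
        gcongr
        · exact sum_range_cast_sq_le n
        · exact sum_range_cast_le n
    _ = n * (P / 3 + Q / 2) := by field_simp
    _ ≤ _ := by
        gcongr
        rw [hP, hQ]
        have : 0 ≤ η ^ 2 * ((1 - β) * ‖D‖ ^ 2) := by positivity
        linarith

/-- Mean squared drift to the last iterate of an epoch. -/
lemma mean_drift_to_end_le {n : ℕ} (hn : 1 ≤ n) {β η V a : ℝ} (hβ0 : 0 ≤ β)
    (hβ1 : β ≤ 1) {m D : E} {w g h : ℕ → E}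
    (hw : ∀ i, i < n → w (i + 1) = w i - (η / (n : ℝ)) • (β • m + (1 - β) • g i))
    (hV : (n : ℝ)⁻¹ * ∑ j ∈ range n, ‖h j - D‖ ^ 2 ≤ V)
    (ha : (n : ℝ)⁻¹ * ∑ j ∈ range n, ‖g j - h j‖ ^ 2 ≤ a) :
    (n : ℝ)⁻¹ * ∑ i ∈ range n, ‖w n - w i‖ ^ 2
      ≤ η ^ 2 * (β * ‖m‖ ^ 2 + 3 * (1 - β) * (‖D‖ ^ 2 + V + a)) := by
  have hn0 : (0 : ℝ) < n := by exact_mod_cast hn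
  have hβ1' := sub_nonneg.2 hβ1
  have hV0 : 0 ≤ V := le_trans (by positivity) hV
  have ha0 : 0 ≤ a := le_trans (by positivity) ha
  rw [inv_mul_le_iff₀ hn0]
  refine (sum_le_card_nsmul _ _ _ fun i hi => ?_).trans_eq
    (by rw [card_range, nsmul_eq_mul])
  refine (epoch_displacement_sq_le hn hβ0 hβ1 hw hV ha (mem_range.1 hi).le le_rfl).trans ?_
  have hk0 : (0 : ℝ) ≤ ((n - i : ℕ) : ℝ) / n := by positivity
  have hk1 : ((n - i : ℕ) : ℝ) / n ≤ 1 := by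
    rw [div_le_one hn0]; exact_mod_cast Nat.sub_le n i
  have hksq : (((n - i : ℕ) : ℝ) / n) ^ 2 ≤ 1 := pow_le_one₀ hk0 hk1
  rw [add_assoc]
  gcongr
  · exact mul_le_of_le_one_left (by positivity) hksq
  · exact mul_le_of_le_one_left (by positivity) hksq
  · exact mul_le_of_le_one_left (by positivity) hk1

/-- One epoch of the momentum method decreases the potential
`F x + η (β/2 ‖∇F x - m‖² + 3/4 p ‖m‖²)`, where `p` bounds `(L η)²`. -/
theorem epoch_potential_le [CompleteSpace E] {n : ℕ} (hn : 1 ≤ n) {F : E → ℝ}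
    (hF : Differentiable ℝ F) {φ : ℕ → E → E} {L Θ σ β η p : ℝ} (hL : 0 < L)
    (hΘ : 0 ≤ Θ) (hβ0 : 0 ≤ β) (hβ1 : β < 1) (hη : 0 ≤ η)
    (hηp : L ^ 2 * η ^ 2 ≤ p) (hp45 : p ≤ 1 / 45) (hpΘ : p * (Θ + 1) ≤ (1 - β) / 18)
    (hgrad : ∀ x, gradient F x = (n : ℝ)⁻¹ • ∑ j ∈ range n, φ j x)
    (hφ : ∀ j, j < n → ∀ x y, ‖φ j x - φ j y‖ ≤ L * ‖x - y‖)
    (hvar : ∀ x, (n : ℝ)⁻¹ * ∑ j ∈ range n, ‖φ j x - gradient F x‖ ^ 2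
      ≤ Θ * ‖gradient F x‖ ^ 2 + σ ^ 2)
    {w : ℕ → E} {m m' : E}
    (hw : ∀ i, i < n →
      w (i + 1) = w i - (η / (n : ℝ)) • (β • m + (1 - β) • φ i (w i)))
    (hm' : m' = (n : ℝ)⁻¹ • ∑ j ∈ range n, φ j (w j)) :
    F (w n) + η * (1 / 2 * β * ‖gradient F (w n) - m'‖ ^ 2 + 3 / 4 * p * ‖m'‖ ^ 2)
      ≤ F (w 0) + η * (1 / 2 * β * ‖gradient F (w 0) - m‖ ^ 2 + 3 / 4 * p * ‖m‖ ^ 2)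
        - η * (1 / 2 * ‖gradient F (w 0)‖ ^ 2)
        + η * ((1 - β) / 4 * ‖gradient F (w 0)‖ ^ 2) + η * (9 / 2 * (p * σ ^ 2)) := by
  have hn0 : (0 : ℝ) < n := by exact_mod_cast hn
  have hα : 0 < 1 - β := by linarith
  have hp : 0 ≤ p := le_trans (by positivity) hηp
  have hmean : ∀ y : E, ‖gradient F y - m'‖ ^ 2
      ≤ L ^ 2 * ((n : ℝ)⁻¹ * ∑ j ∈ range n, ‖y - w j‖ ^ 2) := by
    intro y
    rw [hgrad, hm', ← smul_sub, ← sum_sub_distrib]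
    refine (norm_average_sq_le hn _).trans ?_
    rw [mul_left_comm, mul_sum _ _ (L ^ 2)]
    refine mul_le_mul_of_nonneg_left (sum_le_sum fun j hj => ?_) (inv_nonneg.2 hn0.le)
    rw [← mul_pow]
    exact pow_le_pow_left₀ (norm_nonneg _) (hφ j (mem_range.1 hj) _ _) 2
  have hLip : ∀ x y, ‖gradient F x - gradient F y‖ ≤ L * ‖x - y‖ := by
    intro x y
    rw [hgrad, hgrad, ← smul_sub, ← sum_sub_distrib, norm_smul, norm_inv, Real.norm_natCast,
      inv_mul_le_iff₀ hn0]
    refine (norm_sum_le_of_le _ fun j hj => hφ j (mem_range.1 hj) x y).trans_eq ?_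
    rw [sum_const, card_range, nsmul_eq_mul]
  set D := gradient F (w 0) with hD
  set V := Θ * ‖D‖ ^ 2 + σ ^ 2 with hVdef
  set A := (n : ℝ)⁻¹ * ∑ i ∈ range n, ‖w i - w 0‖ ^ 2 with hA
  set a := L ^ 2 * A with hadef
  have hA0 : 0 ≤ A := by positivity
  have ha0 : 0 ≤ a := by positivity
  have hV : (n : ℝ)⁻¹ * ∑ j ∈ range n, ‖φ j (w 0) - D‖ ^ 2 ≤ V := hvar (w 0)
  have ha : (n : ℝ)⁻¹ * ∑ j ∈ range n, ‖φ j (w j) - φ j (w 0)‖ ^ 2 ≤ a := by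
    rw [hadef, hA, mul_left_comm, mul_sum _ _ (L ^ 2)]
    refine mul_le_mul_of_nonneg_left (sum_le_sum fun j hj => ?_) (inv_nonneg.2 hn0.le)
    rw [← mul_pow]
    exact pow_le_pow_left₀ (norm_nonneg _) (hφ j (mem_range.1 hj) _ _) 2
  have hV0 : 0 ≤ V := by positivity
  have h₁ : a ≤ p * (β / 3 * ‖m‖ ^ 2 + 3 / 2 * (1 - β) * (‖D‖ ^ 2 + V + a)) := by
    have := mean_drift_from_start_le hn hβ0 hβ1.le hw hV ha
    calc a ≤ L ^ 2 * (η ^ 2 * (β / 3 * ‖m‖ ^ 2 + 3 / 2 * (1 - β) * (‖D‖ ^ 2 + V + a))) := by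
          rw [hadef]; gcongr
      _ ≤ _ := by rw [← mul_assoc]; gcongr
  have h₂ : ‖gradient F (w n) - m'‖ ^ 2
      ≤ p * (β * ‖m‖ ^ 2 + 3 * (1 - β) * (‖D‖ ^ 2 + V + a)) := by
    have := mean_drift_to_end_le hn hβ0 hβ1.le hw hV ha
    calc ‖gradient F (w n) - m'‖ ^ 2
        ≤ L ^ 2 * (η ^ 2 * (β * ‖m‖ ^ 2 + 3 * (1 - β) * (‖D‖ ^ 2 + V + a))) := by
          refine (hmean (w n)).trans ?_; gcongr
      _ ≤ _ := by rw [← mul_assoc]; gcongr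
  have hDm : ‖D - m'‖ ^ 2 ≤ a := by
    refine (hmean (w 0)).trans_eq ?_
    simp only [hadef, hA, norm_sub_rev (w 0)]
  have h₃ : ‖m'‖ ^ 2 ≤ 2 * ‖D‖ ^ 2 + 2 * a := by
    have htri : ‖m'‖ ≤ ‖D‖ + ‖D - m'‖ := by
      simpa using norm_sub_le D (D - m')
    nlinarith [norm_nonneg m', sq_nonneg (‖D‖ - ‖D - m'‖)]
  have hpE : p * (‖D‖ ^ 2 + V) ≤ (1 - β) / 18 * ‖D‖ ^ 2 + p * σ ^ 2 := by
    have := mul_le_mul_of_nonneg_right hpΘ (sq_nonneg ‖D‖)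
    rw [hVdef]; linarith
  have hpβ : p ≤ (1 - β) / 18 := by nlinarith
  have hbal := drift_balance hβ0 hβ1 hp hp45 hpβ (sq_nonneg ‖D‖) (sq_nonneg σ)
    (by positivity) (sq_nonneg ‖m‖) ha0 hpE h₁ h₂ h₃
  have hstep : w n = w 0 - η • (β • m + (1 - β) • m') := by
    have h := epoch_displacement_eq hw (Nat.zero_le n) le_rfl
    rw [← range_eq_Ico, sum_add_distrib, sum_const, card_range, ← smul_sum,
      ← Nat.cast_smul_eq_nsmul ℝ] at h
    rw [sub_eq_iff_eq_add'.1 h, hm', ← sub_eq_add_neg]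
    congr 1
    simp only [smul_add, smul_smul]
    congr 2 <;> field_simp
  have hLη : L * η ≤ 1 := by
    have : (L * η) ^ 2 ≤ 1 := by rw [mul_pow]; linarith
    nlinarith [mul_nonneg hL.le hη]
  have hdesc := descent_of_inexact_gradient_step hF hLip hη hLη (w 0) (β • m + (1 - β) • m')
  rw [← hstep, ← hD] at hdesc
  have hconv : ‖D - (β • m + (1 - β) • m')‖ ^ 2 ≤ β * ‖D - m‖ ^ 2 + (1 - β) * a := by
    have hsplit : D - (β • m + (1 - β) • m') = β • (D - m) + (1 - β) • (D - m') := by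
      module
    rw [hsplit]
    refine (norm_convexCombo_sq_le hβ0 hβ1.le _ _).trans ?_
    gcongr
  have h4 := mul_le_mul_of_nonneg_left hconv hη
  have h5 := mul_le_mul_of_nonneg_left hbal hη
  linarith

end Epoch

lemma gradient_const_mul_sum {E ι : Type*} [NormedAddCommGroup E] [InnerProductSpace ℝ E]
    [CompleteSpace E] [Fintype ι] {f : ι → E → ℝ} (hf : ∀ i, Differentiable ℝ (f i)) (c : ℝ)
    (x : E) :
    gradient (fun x => c * ∑ i, f i x) x = c • ∑ i, gradient (f i) x := by
  refine HasGradientAt.gradient ?_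
  rw [hasGradientAt_iff_hasFDerivAt, map_smul, map_sum]
  simp only [toDual_gradient]
  exact (HasFDerivAt.fun_sum fun i _ => (hf i x).hasFDerivAt).const_mul c

theorem smg_cosine_lr
    (n d : ℕ) (hn : 1 ≤ n) (hd : 1 ≤ d)
    (f : Fin n → EuclideanSpace ℝ (Fin d) → ℝ)
    (hf : ∀ i, Differentiable ℝ (f i))
    (F : EuclideanSpace ℝ (Fin d) → ℝ)
    (hF : F = fun x => (1 / (n : ℝ)) * ∑ i, f i x)
    (L : ℝ) (hL : 0 < L)
    (hsmooth : ∀ i x y, ‖gradient (f i) x - gradient (f i) y‖ ≤ L * ‖x - y‖)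
    (Θ σ : ℝ) (hΘ : 0 ≤ Θ) (hσ : 0 ≤ σ)
    (hvar : ∀ x, (1 / (n : ℝ)) * ∑ i, ‖gradient (f i) x - gradient F x‖ ^ 2
        ≤ Θ * ‖gradient F x‖ ^ 2 + σ ^ 2)
    (Fstar : ℝ) (hFstar : IsGLB (Set.range F) Fstar)
    (T : ℕ) (hT : 1 ≤ T)
    (β : ℝ) (hβ0 : 0 ≤ β) (hβ1 : β < 1)
    (η : ℕ → ℝ) (hηnn : ∀ t, 1 ≤ t → t ≤ T → 0 ≤ η t)
    (π : ℕ → Equiv.Perm (Fin n))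
    (w m v g : ℕ → ℕ → EuclideanSpace ℝ (Fin d))
    (wt mt : ℕ → EuclideanSpace ℝ (Fin d))
    (hmt0 : mt 0 = 0)
    (hw0 : ∀ t, 1 ≤ t → t ≤ T → w t 0 = wt (t - 1))
    (hm0 : ∀ t, 1 ≤ t → t ≤ T → m t 0 = mt (t - 1))
    (hv0 : ∀ t, 1 ≤ t → t ≤ T → v t 0 = 0)
    (hg : ∀ t, 1 ≤ t → t ≤ T → ∀ i, ∀ hi : i < n,
        g t i = gradient (f (π t ⟨i, hi⟩)) (w t i))
    (hm1 : ∀ t, 1 ≤ t → t ≤ T → ∀ i, i < n →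
        m t (i + 1) = β • m t 0 + (1 - β) • g t i)
    (hv1 : ∀ t, 1 ≤ t → t ≤ T → ∀ i, i < n →
        v t (i + 1) = v t i + ((n : ℝ))⁻¹ • g t i)
    (hw1 : ∀ t, 1 ≤ t → t ≤ T → ∀ i, i < n →
        w t (i + 1) = w t i - (η t / (n : ℝ)) • m t (i + 1))
    (hwt : ∀ t, 1 ≤ t → t ≤ T → wt t = w t n)
    (hmt : ∀ t, 1 ≤ t → t ≤ T → mt t = v t n)
    (K : ℝ) (hKdef : K = max (5 / 2) (9 * (5 - 3 * β) * (Θ + 1) / (1 - β)))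
    (γ : ℝ) (hγ : 0 < γ) (hT2 : 2 ≤ T)
    (hη : ∀ t, 1 ≤ t → t ≤ T →
        η t = γ / (T : ℝ) ^ ((1 : ℝ) / 3) * (1 + Real.cos ((t : ℝ) * Real.pi / (T : ℝ))))
    (hηK : 2 * γ / (T : ℝ) ^ ((1 : ℝ) / 3) ≤ 1 / (L * Real.sqrt K)) :
    (∑ t ∈ Icc 1 T, η t * ‖gradient F (wt (t - 1))‖ ^ 2) / (∑ t ∈ Icc 1 T, η t)
      ≤ (1 / (T : ℝ) ^ ((2 : ℝ) / 3))
          * (8 * (F (wt 0) - Fstar) / ((1 - β) * γ)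
            + 144 * σ ^ 2 * (5 - 3 * β) * L ^ 2 * γ ^ 2 / (1 - β)) := by
  have hT0 : (0 : ℝ) < T := by exact_mod_cast hT
  have hR : (0 : ℝ) < (T : ℝ) ^ ((1 : ℝ) / 3) := by positivity
  have hR2 : (T : ℝ) ^ ((2 : ℝ) / 3) = ((T : ℝ) ^ ((1 : ℝ) / 3)) ^ 2 := by
    rw [← Real.rpow_mul_natCast hT0.le]; norm_num
  have hgradF : ∀ x, gradient F x = (n : ℝ)⁻¹ • ∑ i, gradient (f i) x := by
    rw [hF, one_div]
    exact fun x => gradient_const_mul_sum hf _ x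
  have hFdiff : Differentiable ℝ F := by
    rw [hF]; fun_prop
  -- components in the order of visit
  set φ : ℕ → ℕ → EuclideanSpace ℝ (Fin d) → EuclideanSpace ℝ (Fin d) :=
    fun t j x => if hj : j < n then gradient (f (π t ⟨j, hj⟩)) x else 0 with hφdef
  have hφ : ∀ t (i : Fin n) x, φ t i x = gradient (f (π t i)) x := fun t i x => by
    simp [hφdef]
  have hgradφ : ∀ t x, gradient F x = (n : ℝ)⁻¹ • ∑ j ∈ range n, φ t j x := fun t x => by
    rw [hgradF, ← Fin.sum_univ_eq_sum_range (fun j => φ t j x),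
      ← Equiv.sum_comp (π t) fun i => gradient (f i) x]
    simp only [hφ]
  have hvarφ : ∀ t x, (n : ℝ)⁻¹ * ∑ j ∈ range n, ‖φ t j x - gradient F x‖ ^ 2
      ≤ Θ * ‖gradient F x‖ ^ 2 + σ ^ 2 := fun t x => by
    rw [← Fin.sum_univ_eq_sum_range (fun j => ‖φ t j x - gradient F x‖ ^ 2), ← one_div]
    simp only [hφ]
    rw [Equiv.sum_comp (π t) fun i => ‖gradient (f i) x - gradient F x‖ ^ 2]
    exact hvar x
  have hLipφ : ∀ t j, j < n → ∀ x y, ‖φ t j x - φ t j y‖ ≤ L * ‖x - y‖ := fun t j hj x y => by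
    simpa [hφdef, hj] using hsmooth (π t ⟨j, hj⟩) x y
  -- step sizes
  set c := 2 * γ / (T : ℝ) ^ ((1 : ℝ) / 3) with hc
  have hc0 : 0 < c := by positivity
  have hηc : ∀ t, 1 ≤ t → t ≤ T → η t ≤ c := fun t h1 h2 => by
    have hcos := Real.cos_le_one ((t : ℝ) * Real.pi / T)
    calc η t ≤ γ / (T : ℝ) ^ ((1 : ℝ) / 3) * 2 := by
          rw [hη t h1 h2]
          exact mul_le_mul_of_nonneg_left (by linarith) (by positivity)
      _ = c := by rw [hc]; ring
  have hηanti : ∀ t, 1 ≤ t → t + 1 ≤ T → η (t + 1) ≤ η t := fun t h1 h2 => by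
    rw [hη t h1 (by omega), hη (t + 1) (by omega) h2]
    have : Real.cos (((t + 1 : ℕ) : ℝ) * Real.pi / T) ≤ Real.cos ((t : ℝ) * Real.pi / T) := by
      apply Real.cos_le_cos_of_nonneg_of_le_pi
      · positivity
      · rw [div_le_iff₀ hT0, mul_comm Real.pi]
        gcongr
      · gcongr
        simp
    gcongr
  set S := ∑ t ∈ Icc 1 T, η t with hS
  have hSlb : γ * ((T : ℝ) ^ ((1 : ℝ) / 3)) ^ 2 / 2 ≤ S := by
    rw [hS, sum_congr rfl fun t ht => hη t (mem_Icc.1 ht).1 (mem_Icc.1 ht).2]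
    exact le_sum_cosine_annealing hγ.le T hT2
  -- consequences of the step-size condition
  set p := L ^ 2 * c ^ 2 with hp
  have hp0 : 0 < p := by positivity
  obtain ⟨hp45, hpΘ⟩ := stepsize_constants hL hc0.le hΘ hβ0 hβ1 (hKdef ▸ hηK)
  have hηp : ∀ t, 1 ≤ t → t ≤ T → L ^ 2 * η t ^ 2 ≤ p := fun t h1 h2 => by
    rw [hp]
    have := hηc t h1 h2
    have := hηnn t h1 h2
    gcongr
  -- the per-epoch inequality
  set Φ : ℕ → ℝ := fun t => 1 / 2 * β * ‖gradient F (wt t) - mt t‖ ^ 2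
    + 3 / 4 * p * ‖mt t‖ ^ 2 with hΦ
  have hΦ0 : ∀ t, 0 ≤ Φ t := fun t => by positivity
  have hepoch : ∀ t, 1 ≤ t → t ≤ T →
      F (wt t) + η t * Φ t ≤ F (wt (t - 1)) + η t * Φ (t - 1)
        - η t * (1 / 2 * ‖gradient F (wt (t - 1))‖ ^ 2)
        + η t * ((1 - β) / 4 * ‖gradient F (wt (t - 1))‖ ^ 2) + η t * (9 / 2 * (p * σ ^ 2)) := by
    intro t h1 h2
    have hgφ : ∀ i, i < n → g t i = φ t i (w t i) := fun i hi => by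
      simp [hφdef, hi, hg t h1 h2 i hi]
    have hmt' : mt t = (n : ℝ)⁻¹ • ∑ j ∈ range n, φ t j (w t j) := by
      have hv : ∀ k, k ≤ n → v t k = (n : ℝ)⁻¹ • ∑ j ∈ range k, φ t j (w t j) := by
        intro k
        induction k with
        | zero => simp [hv0 t h1 h2]
        | succ k ih =>
          intro hk
          rw [hv1 t h1 h2 k hk, ih (by omega), sum_range_succ, smul_add, hgφ k hk]
      rw [hmt t h1 h2, hv n le_rfl]
    have h := epoch_potential_le hn hFdiff hL hΘ hβ0 hβ1 (hηnn t h1 h2) (hηp t h1 h2) hp45 hpΘ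
      (hgradφ t) (hLipφ t) (hvarφ t) (w := w t) (m := mt (t - 1))
      (fun i hi => by rw [hw1 t h1 h2 i hi, hm1 t h1 h2 i hi, hm0 t h1 h2, hgφ i hi]) hmt'
    rwa [← hwt t h1 h2, hw0 t h1 h2] at h
  have hfinal : F (wt T) + η T * Φ T
      + (1 - β) / 4 * ∑ s ∈ Icc 1 T, η s * ‖gradient F (wt (s - 1))‖ ^ 2
        ≤ F (wt 0) + 9 / 2 * (p * σ ^ 2) * S :=
    weighted_sum_le_of_potential (u := fun t => F (wt t))
      (G := fun t => ‖gradient F (wt (t - 1))‖ ^ 2) hβ0 hηnn hηanti hΦ0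
      (fun t => sq_nonneg _) (by simp [hΦ, hmt0]) hepoch T hT le_rfl
  have hstar : ∀ x, Fstar ≤ F x := fun x => hFstar.1 ⟨x, rfl⟩
  have hΔ : 0 ≤ F (wt 0) - Fstar := sub_nonneg.2 (hstar _)
  have hΦT : 0 ≤ η T * Φ T := mul_nonneg (hηnn T hT le_rfl) (hΦ0 T)
  have hsum : (1 - β) / 4 * ∑ s ∈ Icc 1 T, η s * ‖gradient F (wt (s - 1))‖ ^ 2
      ≤ (F (wt 0) - Fstar) + 9 / 2 * (p * σ ^ 2) * S := by
    linarith [hstar (wt T)]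
  rw [hR2]
  exact weighted_average_le hβ1 hγ hR hΔ hSlb hsum
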